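/- Replacement of f by its leading characteristic part (content of Lemma 2): let f̂(x,y) := Ĉ((x+y)/2)·((x−y)/2)^m and let ⟨Â⟩(Δr) denote the averaged quantity defined exactly as ⟨A⟩(Δr) but with f replaced by f̂ (same ε, δ, m). Let q be the LOE exponent of (m, ε, δ), namely q = m−2 if m is even and ε = δ = 1; q = m if m is even and (ε,δ) ≠ (1,1); q = m−1 if m is odd and (ε = −1 or δ = 1); q = m+1 if m is odd, ε = 1 and δ = −1. Then ⟨A⟩(Δr) − ⟨Â⟩(Δr) = O(Δr^{q+2}) as Δr → 0⁺; i.e., replacing f by f̂ does not affect the leading-order terms of ⟨A⟩. -/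

import Mathlib

open Filter Finset

noncomputable section

/-- Transition probability η on trits: η(0) = (β/2)(1 − Pe/2), η(1) = 1 − β,
η(2) = (β/2)(1 + Pe/2). -/
def eta (β Pe : ℝ) (ω : Fin 3) : ℝ :=
  if (ω : ℕ) = 0 then β / 2 * (1 - Pe / 2)
  else if (ω : ℕ) = 1 then 1 - β
  else β / 2 * (1 + Pe / 2)

/-- ν(ω) = η(2 − ω). -/
def nu (β Pe : ℝ) (ω : Fin 3) : ℝ :=
  if (ω : ℕ) = 0 then β / 2 * (1 + Pe / 2)
  else if (ω : ℕ) = 1 then 1 - β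
  else β / 2 * (1 - Pe / 2)

/-- Bulk local density ρ̂ⱼ(u′) = (∏ η(u_d)/ν(u_d)) · ρ₀(r + (j + Σ (1 − u_d))·Δr). -/
def rhoHat (β Pe r Δr : ℝ) (ρ₀ : ℝ → ℝ) {K : ℕ} (j : ℤ) (u : Fin K → Fin 3) : ℝ :=
  (∏ d, eta β Pe (u d) / nu β Pe (u d)) *
    ρ₀ (r + ((j : ℝ) + ∑ d, (1 - ((u d : ℕ) : ℝ))) * Δr)

/-- F_j(ω, u) with u = u₀u′ :
F_j(ω,u) = f((η(ω)/ν(ω))·ρ̂_j(u′), (η(u₀)/ν(u₀))·ρ̂_{j+1−u₀}(u′)). -/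
def Floc (β Pe r Δr : ℝ) (ρ₀ : ℝ → ℝ) (f : ℝ → ℝ → ℝ) {K : ℕ}
    (j : ℤ) (ω u₀ : Fin 3) (u' : Fin K → Fin 3) : ℝ :=
  f (eta β Pe ω / nu β Pe ω * rhoHat β Pe r Δr ρ₀ j u')
    (eta β Pe u₀ / nu β Pe u₀ * rhoHat β Pe r Δr ρ₀ (j + 1 - ((u₀ : ℕ) : ℤ)) u')

/-- K(Δr): the sum over the trit ω and the k-digit trit string u = u₀u′. -/
def Ksum (D v β r : ℝ) (k : ℕ) (ρ₀ : ℝ → ℝ) (f : ℝ → ℝ → ℝ)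
    (ε δ : ℝ) (m : ℕ) (Δr : ℝ) : ℝ :=
  Δr * ∑ ω : Fin 3, ∑ u₀ : Fin 3, ∑ u' : Fin (k - 1) → Fin 3,
    (eta β (v * Δr / D) ω + δ * nu β (v * Δr / D) ω) *
      (nu β (v * Δr / D) u₀ * ∏ d, nu β (v * Δr / D) (u' d)) *
      (Floc β (v * Δr / D) r Δr ρ₀ f 0 ω u₀ u' +
        ε * (-1 : ℝ) ^ m * Floc β (v * Δr / D) r Δr ρ₀ f (1 - ((ω : ℕ) : ℤ)) ω u₀ u')

/-- The spatio-temporally averaged T¹-type quantity ⟨A⟩(Δr) = K/(τ·Δr),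
with τ = β·Δr²/(2D). -/
def avgA (D v β r : ℝ) (k : ℕ) (ρ₀ : ℝ → ℝ) (f : ℝ → ℝ → ℝ)
    (ε δ : ℝ) (m : ℕ) (Δr : ℝ) : ℝ :=
  Ksum D v β r k ρ₀ f ε δ m Δr / (β * Δr ^ 2 / (2 * D) * Δr)

/-- f̃(X,Y) = f(Y + X, Y − X). -/
def ftilde (f : ℝ → ℝ → ℝ) (X Y : ℝ) : ℝ := f (Y + X) (Y - X)


open scoped Classical

open Topology Asymptotics MeasureTheory
open scoped ContDiff

universe u

/-- Integrals over `[0, 1]` of jointly `C^n` functions are `C^n` in the parameter. -/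
theorem contDiff_nat_intervalIntegral {E : Type u} [NormedAddCommGroup E] [NormedSpace ℝ E]
    [ProperSpace E] (n : ℕ) {F : Type u} [NormedAddCommGroup F] [NormedSpace ℝ F]
    (Φ : E × ℝ → F) (hΦ : ContDiff ℝ n Φ) :
    ContDiff ℝ n (fun x => ∫ t in (0 : ℝ)..1, Φ (x, t)) := by
  induction n generalizing F with
  | zero =>
    have hc : Continuous Φ := hΦ.continuous
    exact contDiff_zero.2 (intervalIntegral.continuous_parametric_intervalIntegral_of_continuous'
      (f := fun x t => Φ (x, t)) (by exact hc) 0 1)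
  | succ n ih =>
    rw [Nat.cast_add, Nat.cast_one] at hΦ ⊢
    have hdiff : Differentiable ℝ Φ := hΦ.differentiable (by simp)
    let Φ' : E × ℝ → E →L[ℝ] F := fun p => (fderiv ℝ Φ p).comp (ContinuousLinearMap.inl ℝ E ℝ)
    have hΦ' : ContDiff ℝ n Φ' := (hΦ.fderiv_right le_rfl).clm_comp contDiff_const
    have hcont : Continuous Φ := hΦ.continuous
    have hcont' : Continuous Φ' := hΦ'.continuous
    refine contDiff_succ_iff_hasFDerivAt.2 ⟨fun x => ∫ t in (0 : ℝ)..1, Φ' (x, t), ih Φ' hΦ', ?_⟩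
    intro x₀
    obtain ⟨B, hB⟩ := ((isCompact_closedBall x₀ 1).prod (isCompact_Icc (a := (0 : ℝ)) (b := 1)))
      |>.exists_bound_of_continuousOn hcont'.continuousOn
    refine intervalIntegral.hasFDerivAt_integral_of_dominated_of_fderiv_le (𝕜 := ℝ)
      (F := fun x t => Φ (x, t)) (F' := fun x t => Φ' (x, t)) (bound := fun _ => B)
      (Metric.closedBall_mem_nhds x₀ one_pos) ?_ ?_ ?_ ?_ ?_ ?_
    · exact Eventually.of_forall fun x =>
        (hcont.comp (Continuous.prodMk_right x)).aestronglyMeasurable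
    · exact (hcont.comp (Continuous.prodMk_right x₀)).intervalIntegrable _ _
    · exact (hcont'.comp (Continuous.prodMk_right x₀)).aestronglyMeasurable
    · refine Eventually.of_forall fun t ht x hx => hB (x, t) ⟨hx, ?_⟩
      rw [Set.uIoc_of_le zero_le_one] at ht
      exact ⟨ht.1.le, ht.2⟩
    · exact intervalIntegrable_const
    · exact Eventually.of_forall fun t _ x _ =>
        (hdiff (x, t)).hasFDerivAt.comp x (hasFDerivAt_prodMk_left x t)

/-- **Hadamard's lemma** in the first variable. -/
theorem exists_contDiff_eq_fst_mul (φ : ℝ × ℝ → ℝ) (hφ : ContDiff ℝ ∞ φ)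
    (h0 : ∀ Y, φ (0, Y) = 0) :
    ∃ ψ : ℝ × ℝ → ℝ, ContDiff ℝ ∞ ψ ∧ ∀ X Y, φ (X, Y) = X * ψ (X, Y) := by
  have hd : ContDiff ℝ ∞ fun q : (ℝ × ℝ) × ℝ => fderiv ℝ φ (q.2 * q.1.1, q.1.2) (1, 0) := by
    have h1 : ContDiff ℝ ∞ (fderiv ℝ φ) := hφ.fderiv_right (by simp)
    exact (h1.comp (by fun_prop : ContDiff ℝ ∞
      fun q : (ℝ × ℝ) × ℝ => (q.2 * q.1.1, q.1.2))).clm_apply contDiff_const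
  refine ⟨fun p => ∫ t in (0 : ℝ)..1, fderiv ℝ φ (t * p.1, p.2) (1, 0), ?_, fun X Y => ?_⟩
  · exact contDiff_infty.2 fun n => contDiff_nat_intervalIntegral n _ (contDiff_infty.1 hd n)
  · have hderiv : ∀ t ∈ Set.uIcc (0 : ℝ) 1, HasDerivAt (fun t : ℝ => φ (t * X, Y))
        (X * fderiv ℝ φ (t * X, Y) (1, 0)) t := by
      intro t _
      have h1 : HasDerivAt (fun t : ℝ => (t * X, Y)) (X, 0) t := by
        simpa using ((hasDerivAt_id t).mul_const X).prodMk (hasDerivAt_const t Y)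
      have h2 := ((hφ.differentiable (by simp)) (t * X, Y)).hasFDerivAt.comp_hasDerivAt t h1
      have h3 : fderiv ℝ φ (t * X, Y) (X, 0) = X * fderiv ℝ φ (t * X, Y) (1, 0) := by
        have := (fderiv ℝ φ (t * X, Y)).map_smul X ((1 : ℝ), (0 : ℝ))
        simpa using this
      exact h3 ▸ h2
    have hint := intervalIntegral.integral_eq_sub_of_hasDerivAt hderiv (by
      apply Continuous.intervalIntegrable
      exact continuous_const.mul (hd.continuous.comp (Continuous.prodMk_right (X, Y))))
    rw [intervalIntegral.integral_const_mul] at hint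
    simp only [one_mul, zero_mul, h0, sub_zero] at hint
    exact hint.symm

theorem iteratedDeriv_pow_mul_zero (n : ℕ) (h : ℝ → ℝ) (hh : ContDiff ℝ ∞ h) :
    iteratedDeriv n (fun x => x ^ n * h x) 0 = n.factorial * h 0 := by
  have := iteratedDeriv_mul (n := n) (x := (0 : ℝ)) (f := fun x : ℝ => x ^ n) (g := h)
    (by fun_prop) ((contDiff_infty.1 hh n).contDiffAt)
  change iteratedDeriv n ((fun x => x ^ n) * h) 0 = _
  rw [this, Finset.sum_eq_single n]
  · rw [iteratedDeriv_fun_pow_zero]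
    simp
  · intro b _ hb
    rw [iteratedDeriv_fun_pow_zero]
    simp [hb]
  · simp

theorem exists_contDiff_eq_fst_pow_mul (φ : ℝ × ℝ → ℝ) (hφ : ContDiff ℝ ∞ φ) (m : ℕ)
    (h0 : ∀ Y, ∀ j < m, iteratedDeriv j (fun X => φ (X, Y)) 0 = 0) :
    ∃ ψ : ℝ × ℝ → ℝ, ContDiff ℝ ∞ ψ ∧ ∀ X Y, φ (X, Y) = X ^ m * ψ (X, Y) := by
  induction m with
  | zero => exact ⟨φ, hφ, by simp⟩
  | succ m ih =>
    obtain ⟨ψ, hψ, hφψ⟩ := ih fun Y j hj => h0 Y j (by omega)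
    have hψ0 : ∀ Y, ψ (0, Y) = 0 := by
      intro Y
      have h := h0 Y m (by omega)
      simp only [hφψ] at h
      rw [iteratedDeriv_pow_mul_zero m (fun X => ψ (X, Y)) (by fun_prop)] at h
      exact (mul_eq_zero.1 h).resolve_left (by positivity)
    obtain ⟨χ, hχ, hψχ⟩ := exists_contDiff_eq_fst_mul ψ hψ hψ0
    exact ⟨χ, hχ, fun X Y => by rw [hφψ, hψχ]; ring⟩

/-- A smooth function of parity `m` in `X` that vanishes to order `m` along `X = 0` differs from
its leading part by `X ^ (m + 2)` times a smooth function. -/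
theorem exists_contDiff_eq_fst_pow_mul_add (φ : ℝ × ℝ → ℝ) (hφ : ContDiff ℝ ∞ φ) (m : ℕ)
    (C : ℝ → ℝ) (h0 : ∀ Y, ∀ j < m, iteratedDeriv j (fun X => φ (X, Y)) 0 = 0)
    (hC : ∀ Y, iteratedDeriv m (fun X => φ (X, Y)) 0 = (m.factorial : ℝ) * C Y)
    (hsym : ∀ X Y, φ (-X, Y) = (-1) ^ m * φ (X, Y)) :
    ContDiff ℝ ∞ C ∧ ∃ ψ : ℝ × ℝ → ℝ, ContDiff ℝ ∞ ψ ∧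
      ∀ X Y, φ (X, Y) - C Y * X ^ m = X ^ (m + 2) * ψ (X, Y) := by
  obtain ⟨h, hh, hφh⟩ := exists_contDiff_eq_fst_pow_mul φ hφ m h0
  have hCh : ∀ Y, C Y = h (0, Y) := by
    intro Y
    have := hC Y
    simp only [hφh] at this
    rw [iteratedDeriv_pow_mul_zero m (fun X => h (X, Y)) (by fun_prop)] at this
    exact (mul_left_cancel₀ (by positivity) this).symm
  have hCs : ContDiff ℝ ∞ C := by
    rw [funext hCh]
    fun_prop
  refine ⟨hCs, ?_⟩
  obtain ⟨h₁, hh₁, hhh₁⟩ := exists_contDiff_eq_fst_mul (fun p => h p - h (0, p.2))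
    (by fun_prop) (by simp)
  simp only at hhh₁
  have heven : ∀ X Y, h (-X, Y) = h (X, Y) := by
    intro X Y
    rcases eq_or_ne X 0 with rfl | hX
    · simp
    have := hsym X Y
    rw [hφh, hφh, neg_pow, mul_assoc] at this
    exact mul_left_cancel₀ (pow_ne_zero m hX) (mul_left_cancel₀ (by simp) this)
  have hodd : ∀ Y, ∀ X ≠ 0, h₁ (-X, Y) = -h₁ (X, Y) := by
    intro Y X hX
    have h1 := hhh₁ (-X) Y
    rw [heven, hhh₁] at h1
    exact mul_left_cancel₀ hX (by linarith)
  have hzero : ∀ Y, h₁ (0, Y) = 0 := by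
    intro Y
    have hc : Continuous fun X : ℝ => h₁ (X, Y) := by
      have := hh₁.continuous
      fun_prop
    have heq : (fun X : ℝ => h₁ (-X, Y)) = fun X => -h₁ (X, Y) :=
      Continuous.ext_on (s := {0}ᶜ) (dense_compl_singleton 0) (hc.comp continuous_neg) hc.neg
        fun X hX => hodd Y X hX
    have := congrFun heq 0
    simp only [neg_zero] at this
    linarith
  obtain ⟨ψ, hψ, hh₁ψ⟩ := exists_contDiff_eq_fst_mul h₁ hh₁ hzero
  refine ⟨ψ, hψ, fun X Y => ?_⟩
  have h1 := hhh₁ X Y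
  rw [hh₁ψ] at h1
  rw [hφh, hCh]
  linear_combination X ^ m * h1

/-- Smooth functions on the line agree to any order with a polynomial. -/
theorem exists_polynomial_isBigO (φ : ℝ → ℝ) (hφ : ContDiffAt ℝ ∞ φ 0) (n : ℕ) :
    ∃ P : Polynomial ℝ, (fun x => φ x - P.eval x) =O[𝓝 0] fun x => x ^ n := by
  obtain ⟨s, hs, hsφ⟩ := hφ.contDiffOn (m := n) (by exact_mod_cast le_top) (by simp)
  obtain ⟨d, hd, hds⟩ := Metric.mem_nhds_iff.1 hs
  have hT := taylor_isLittleO (convex_ball (0 : ℝ) d) (Metric.mem_ball_self hd) (hsφ.mono hds)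
  rw [Metric.isOpen_ball.nhdsWithin_eq (Metric.mem_ball_self hd)] at hT
  refine ⟨∑ k ∈ Finset.range (n + 1), Polynomial.C
    ((k.factorial : ℝ)⁻¹ * iteratedDerivWithin k φ (Metric.ball 0 d) 0) * Polynomial.X ^ k, ?_⟩
  refine (hT.isBigO.congr (fun x => ?_) fun x => by simp)
  rw [taylor_within_apply, Polynomial.eval_finsetSum]
  simp only [sub_zero, smul_eq_mul, Polynomial.eval_mul, Polynomial.eval_C, Polynomial.eval_pow,
    Polynomial.eval_X]
  congr 1
  exact Finset.sum_congr rfl fun k _ => by ring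

theorem X_pow_dvd_of_isBigO (n : ℕ) (P : Polynomial ℝ)
    (hP : (fun x => P.eval x) =O[𝓝[≠] 0] fun x => x ^ n) : Polynomial.X ^ n ∣ P := by
  induction n generalizing P with
  | zero => simp
  | succ n ih =>
    have hP0 : P.eval 0 = 0 := by
      have h1 : Tendsto (fun x : ℝ => x ^ (n + 1)) (𝓝[≠] 0) (𝓝 0) := by
        have : ContinuousAt (fun x : ℝ => x ^ (n + 1)) 0 := by fun_prop
        simpa [ContinuousAt] using this.tendsto.mono_left nhdsWithin_le_nhds
      exact tendsto_nhds_unique (P.continuous.continuousAt.tendsto.mono_left nhdsWithin_le_nhds)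
        (hP.trans_tendsto h1)
    obtain ⟨Q, rfl⟩ : Polynomial.X ∣ P := by
      rw [Polynomial.X_dvd_iff, Polynomial.coeff_zero_eq_eval_zero, hP0]
    rw [pow_succ']
    refine mul_dvd_mul_left _ (ih Q ?_)
    have hinv := (isBigO_refl (fun x : ℝ => x⁻¹) (𝓝[≠] 0)).mul hP
    refine hinv.congr' ?_ ?_
    · filter_upwards [self_mem_nhdsWithin] with x hx
      have hx' : x ≠ 0 := hx
      simp [hx']
    · filter_upwards [self_mem_nhdsWithin] with x hx
      have hx' : x ≠ 0 := hx
      rw [pow_succ']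
      field_simp

theorem isBigO_pow_pow_of_le {p q : ℕ} (h : p ≤ q) :
    (fun x : ℝ => x ^ q) =O[𝓝 0] fun x => x ^ p := by
  have h1 : (fun x : ℝ => x ^ (q - p)) =O[𝓝 0] fun _ => (1 : ℝ) :=
    (continuous_pow (q - p)).continuousAt.isBigO_one ℝ
  refine (h1.mul (isBigO_refl (fun x : ℝ => x ^ p) (𝓝 0))).congr (fun x => ?_) fun x => by simp
  rw [← pow_add, Nat.sub_add_cancel h]

/-- An even smooth function that is `O(x ^ n)` with `n` odd is `O(x ^ (n + 1))`. -/
theorem isBigO_pow_succ_of_even (S : ℝ → ℝ) (hS : ContDiffAt ℝ ∞ S 0)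
    (heven : ∀ x, S (-x) = S x) (n : ℕ) (hn : Odd n) (hO : S =O[𝓝 0] fun x => x ^ n) :
    S =O[𝓝 0] fun x => x ^ (n + 1) := by
  obtain ⟨P, hP⟩ := exists_polynomial_isBigO S hS (n + 1)
  have hle := isBigO_pow_pow_of_le n.le_succ
  obtain ⟨Q, rfl⟩ := X_pow_dvd_of_isBigO n P (by
    refine (((hO.sub (hP.trans hle)).mono nhdsWithin_le_nhds).congr_left fun x => ?_)
    simp)
  obtain ⟨R, hR⟩ : ∃ R : Polynomial ℝ, Q = Polynomial.C (Q.eval 0) + Polynomial.X * R := by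
    obtain ⟨R, hR⟩ : Polynomial.X ∣ Q - Polynomial.C (Q.eval 0) := by
      rw [Polynomial.X_dvd_iff]; simp [Polynomial.coeff_zero_eq_eval_zero]
    exact ⟨R, by rw [← hR]; ring⟩
  set c := Q.eval 0
  have hR1 : (fun x : ℝ => R.eval x) =O[𝓝 0] fun _ => (1 : ℝ) :=
    R.continuous.continuousAt.isBigO_one ℝ
  have hexp : (fun x => S x - c * x ^ n) =O[𝓝 0] fun x => x ^ (n + 1) := by
    have h2 : (fun x : ℝ => x ^ (n + 1) * R.eval x) =O[𝓝 0] fun x => x ^ (n + 1) := by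
      simpa using (isBigO_refl (fun x : ℝ => x ^ (n + 1)) (𝓝 0)).mul hR1
    refine (hP.add h2).congr_left fun x => ?_
    rw [hR]
    simp only [Polynomial.eval_mul, Polynomial.eval_add, Polynomial.eval_C, Polynomial.eval_pow,
      Polynomial.eval_X]
    ring
  have hneg : (fun x => S x + c * x ^ n) =O[𝓝 0] fun x => x ^ (n + 1) := by
    have ht : Tendsto (fun x : ℝ => -x) (𝓝 0) (𝓝 0) := by
      simpa using (continuous_neg (G := ℝ)).tendsto 0
    refine (hexp.comp_tendsto ht).congr (fun x => ?_) fun x => ?_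
    · simp [heven, hn.neg_pow]
    · simp [hn.add_one.neg_pow]
  refine ((hexp.add hneg).const_mul_left (1 / 2)).congr_left fun x => ?_
  ring

theorem isBigO_sq_of_hasDerivAt_zero (W : ℝ → ℝ) (hW : ContDiffAt ℝ ∞ W 0) (h0 : W 0 = 0)
    (hd : HasDerivAt W 0 0) : W =O[𝓝 0] fun x => x ^ 2 := by
  obtain ⟨P, hP⟩ := exists_polynomial_isBigO W hW 2
  have hder : HasDerivAt (fun x => W x - P.eval x) 0 0 := by
    have h1 : (fun x => W x - P.eval x) =O[𝓝 0] fun x => ‖x - 0‖ ^ 2 := by simpa using hP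
    simpa using (h1.hasFDerivAt (𝕜 := ℝ) one_lt_two).hasDerivAt
  have hP0 : P.eval 0 = 0 := by
    have := hP.eq_zero_imp.self_of_nhds (by simp)
    rw [h0] at this
    linarith
  have hP1 : P.derivative.eval 0 = 0 := by
    have h1 : HasDerivAt (fun x => P.eval x) (0 - 0) 0 := by
      simpa using hd.fun_sub hder
    simpa using (P.hasDerivAt 0).unique h1
  obtain ⟨Q, rfl⟩ : Polynomial.X ^ 2 ∣ P := by
    rw [Polynomial.X_pow_dvd_iff]
    intro d hd
    interval_cases d
    · rw [Polynomial.coeff_zero_eq_eval_zero, hP0]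
    · rw [← Polynomial.coeff_zero_eq_eval_zero, Polynomial.coeff_derivative] at hP1
      simpa using hP1
  have hQ : (fun x : ℝ => x ^ 2 * Q.eval x) =O[𝓝 0] fun x => x ^ 2 := by
    simpa using (isBigO_refl (fun x : ℝ => x ^ 2) (𝓝 0)).mul
      (Q.continuous.continuousAt.isBigO_one ℝ)
  exact (hP.add hQ).congr_left fun x => by simp

/-- The sum over trits in `Ksum`, without the prefactor `Δr`. -/
def tritSum (D v β r : ℝ) (k : ℕ) (ρ₀ : ℝ → ℝ) (f : ℝ → ℝ → ℝ)
    (ε δ : ℝ) (m : ℕ) (Δr : ℝ) : ℝ :=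
  ∑ w : Fin 3, ∑ u₀ : Fin 3, ∑ u' : Fin (k - 1) → Fin 3,
    (eta β (v * Δr / D) w + δ * nu β (v * Δr / D) w) *
      (nu β (v * Δr / D) u₀ * ∏ d, nu β (v * Δr / D) (u' d)) *
      (Floc β (v * Δr / D) r Δr ρ₀ f 0 w u₀ u' +
        ε * (-1 : ℝ) ^ m * Floc β (v * Δr / D) r Δr ρ₀ f (1 - ((w : ℕ) : ℤ)) w u₀ u')

theorem tritSum_sub (D v β r : ℝ) (k : ℕ) (ρ₀ : ℝ → ℝ) (f g : ℝ → ℝ → ℝ)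
    (ε δ : ℝ) (m : ℕ) (Δr : ℝ) :
    tritSum D v β r k ρ₀ f ε δ m Δr - tritSum D v β r k ρ₀ g ε δ m Δr =
      tritSum D v β r k ρ₀ (fun x y => f x y - g x y) ε δ m Δr := by
  simp only [tritSum, ← Finset.sum_sub_distrib, Floc]
  refine Finset.sum_congr rfl fun _ _ => Finset.sum_congr rfl fun _ _ =>
    Finset.sum_congr rfl fun _ _ => ?_
  ring

theorem eta_neg_rev (β P : ℝ) (w : Fin 3) : eta β (-P) w.rev = eta β P w := by
  fin_cases w <;> simp [eta, Fin.rev, neg_div, sub_eq_add_neg]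

theorem nu_neg_rev (β P : ℝ) (w : Fin 3) : nu β (-P) w.rev = nu β P w := by
  fin_cases w <;> simp [nu, Fin.rev, neg_div, sub_eq_add_neg]

theorem cast_rev_trit (w : Fin 3) : ((w.rev : ℕ) : ℤ) = 2 - ((w : ℕ) : ℤ) := by
  fin_cases w <;> simp [Fin.rev]

theorem rhoHat_neg_rev (β P r Δr : ℝ) (ρ₀ : ℝ → ℝ) {K : ℕ} (j : ℤ) (u : Fin K → Fin 3) :
    rhoHat β (-P) r (-Δr) ρ₀ (-j) (fun d => (u d).rev) = rhoHat β P r Δr ρ₀ j u := by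
  have hsum : ∑ d, (1 - (((u d).rev : ℕ) : ℝ)) = -∑ d, (1 - ((u d : ℕ) : ℝ)) := by
    rw [← Finset.sum_neg_distrib]
    refine Finset.sum_congr rfl fun d _ => ?_
    have h : (((u d).rev : ℕ) : ℝ) = 2 - ((u d : ℕ) : ℝ) := by
      exact_mod_cast cast_rev_trit (u d)
    rw [h]
    ring
  simp only [rhoHat, eta_neg_rev, nu_neg_rev, hsum]
  congr 2
  push_cast
  ring

theorem Floc_neg_rev (β P r Δr : ℝ) (ρ₀ : ℝ → ℝ) (f : ℝ → ℝ → ℝ) {K : ℕ} (j : ℤ)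
    (w u₀ : Fin 3) (u : Fin K → Fin 3) :
    Floc β (-P) r (-Δr) ρ₀ f (-j) w.rev u₀.rev (fun d => (u d).rev) =
      Floc β P r Δr ρ₀ f j w u₀ u := by
  have hj : -j + 1 - ((u₀.rev : ℕ) : ℤ) = -(j + 1 - ((u₀ : ℕ) : ℤ)) := by
    rw [cast_rev_trit]
    ring
  simp only [Floc, eta_neg_rev, nu_neg_rev, hj, rhoHat_neg_rev]

/-- Reversing the direction of space leaves the sum unchanged. -/
theorem tritSum_neg (D v β r : ℝ) (k : ℕ) (ρ₀ : ℝ → ℝ) (f : ℝ → ℝ → ℝ)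
    (ε δ : ℝ) (m : ℕ) (Δr : ℝ) :
    tritSum D v β r k ρ₀ f ε δ m (-Δr) = tritSum D v β r k ρ₀ f ε δ m Δr := by
  have hP : v * -Δr / D = -(v * Δr / D) := by ring
  unfold tritSum
  rw [← Equiv.sum_comp Fin.revPerm]
  refine Finset.sum_congr rfl fun w _ => ?_
  rw [← Equiv.sum_comp Fin.revPerm]
  refine Finset.sum_congr rfl fun u₀ _ => ?_
  rw [← Equiv.sum_comp (Equiv.arrowCongr (Equiv.refl (Fin (k - 1))) (Fin.revPerm (n := 3)))]
  refine Finset.sum_congr rfl fun u' _ => ?_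
  have hu : (Equiv.arrowCongr (Equiv.refl (Fin (k - 1))) (Fin.revPerm (n := 3))) u' =
      fun d => (u' d).rev := rfl
  have hw : 1 - ((w.rev : ℕ) : ℤ) = -(1 - ((w : ℕ) : ℤ)) := by
    rw [cast_rev_trit]
    ring
  have h0 := Floc_neg_rev β (v * Δr / D) r Δr ρ₀ f 0 w u₀ u'
  rw [neg_zero] at h0
  rw [hu, hP]
  simp only [Fin.revPerm_apply, eta_neg_rev, nu_neg_rev, hw, Floc_neg_rev, h0]

theorem contDiff_eta (β v D : ℝ) (w : Fin 3) : ContDiff ℝ ∞ fun x => eta β (v * x / D) w := by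
  unfold eta
  split_ifs <;> fun_prop

theorem contDiff_nu (β v D : ℝ) (w : Fin 3) : ContDiff ℝ ∞ fun x => nu β (v * x / D) w := by
  unfold nu
  split_ifs <;> fun_prop

theorem nu_zero_pos {β : ℝ} (hβ0 : 0 < β) (hβ1 : β < 1) (w : Fin 3) : 0 < nu β 0 w := by
  unfold nu
  split_ifs <;> simp <;> linarith

theorem eta_zero (β : ℝ) (w : Fin 3) : eta β 0 w = nu β 0 w := by
  simp [eta, nu]

theorem contDiffAt_eta_div_nu {β : ℝ} (hβ0 : 0 < β) (hβ1 : β < 1) (v D : ℝ) (w : Fin 3) :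
    ContDiffAt ℝ ∞ (fun x => eta β (v * x / D) w / nu β (v * x / D) w) 0 :=
  (contDiff_eta β v D w).contDiffAt.div (contDiff_nu β v D w).contDiffAt
    (by simpa using (nu_zero_pos hβ0 hβ1 w).ne')

theorem eta_div_nu_zero {β : ℝ} (hβ0 : 0 < β) (hβ1 : β < 1) (v D : ℝ) (w : Fin 3) :
    eta β (v * 0 / D) w / nu β (v * 0 / D) w = 1 := by
  simp [eta_zero, (nu_zero_pos hβ0 hβ1 w).ne']

theorem contDiffAt_rhoHat {β : ℝ} (hβ0 : 0 < β) (hβ1 : β < 1) (v D r : ℝ) {ρ₀ : ℝ → ℝ}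
    (hρ : ContDiff ℝ ∞ ρ₀) {K : ℕ} (j : ℤ) (u : Fin K → Fin 3) :
    ContDiffAt ℝ ∞ (fun x => rhoHat β (v * x / D) r x ρ₀ j u) 0 := by
  unfold rhoHat
  refine ContDiffAt.mul (contDiffAt_prod fun d _ => contDiffAt_eta_div_nu hβ0 hβ1 v D (u d)) ?_
  exact ContDiff.contDiffAt (by fun_prop)

theorem rhoHat_zero {β : ℝ} (hβ0 : 0 < β) (hβ1 : β < 1) (v D r : ℝ) (ρ₀ : ℝ → ℝ) {K : ℕ}
    (j : ℤ) (u : Fin K → Fin 3) : rhoHat β (v * 0 / D) r 0 ρ₀ j u = ρ₀ r := by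
  simp only [rhoHat, eta_div_nu_zero hβ0 hβ1]
  simp

/-- The derivative of `rhoHat` at vanishing cell size is affine in the cell index. -/
theorem exists_hasDerivAt_rhoHat {β : ℝ} (hβ0 : 0 < β) (hβ1 : β < 1) (v D r : ℝ) {ρ₀ : ℝ → ℝ}
    (hρ : ContDiff ℝ ∞ ρ₀) {K : ℕ} (u : Fin K → Fin 3) :
    ∃ c : ℝ, ∀ j : ℤ,
      HasDerivAt (fun x => rhoHat β (v * x / D) r x ρ₀ j u) (c + j * deriv ρ₀ r) 0 := by
  have hprod : ContDiffAt ℝ ∞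
      (fun x => ∏ d, eta β (v * x / D) (u d) / nu β (v * x / D) (u d)) 0 :=
    contDiffAt_prod fun d _ => contDiffAt_eta_div_nu hβ0 hβ1 v D (u d)
  have h1 := (hprod.differentiableAt (by simp)).hasDerivAt
  set p := deriv (fun x => ∏ d, eta β (v * x / D) (u d) / nu β (v * x / D) (u d)) 0
  set T : ℝ := ∑ d, (1 - ((u d : ℕ) : ℝ))
  refine ⟨p * ρ₀ r + T * deriv ρ₀ r, fun j => ?_⟩
  have h2 : HasDerivAt (fun x : ℝ => r + ((j : ℝ) + T) * x) ((j : ℝ) + T) 0 := by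
    simpa using ((hasDerivAt_id (0 : ℝ)).const_mul ((j : ℝ) + T)).const_add r
  have h3 : HasDerivAt ρ₀ (deriv ρ₀ r) (r + ((j : ℝ) + T) * 0) := by
    simpa using ((hρ.differentiable (by simp)) r).hasDerivAt
  have h4 := h1.fun_mul (h3.comp (0 : ℝ) h2)
  refine h4.congr_deriv ?_
  simp only [eta_div_nu_zero hβ0 hβ1, Function.comp, Finset.prod_const_one]
  rw [mul_zero, add_zero]
  ring

theorem isBigO_id_of_differentiableAt {φ : ℝ → ℝ} (hφ : DifferentiableAt ℝ φ 0) (h0 : φ 0 = 0) :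
    φ =O[𝓝 0] fun x => x := by
  simpa [h0] using hφ.isBigO_sub

theorem isBigO_pow_sub_pow {X X' : ℝ → ℝ} (hX : X =O[𝓝 0] fun x => x)
    (hX' : X' =O[𝓝 0] fun x => x) (h : (fun x => X x - X' x) =O[𝓝 0] fun x => x ^ 2) (n : ℕ) :
    (fun x => X x ^ n - X' x ^ n) =O[𝓝 0] fun x => x ^ (n + 1) := by
  induction n with
  | zero => simpa using isBigO_zero _ _
  | succ n ih =>
    have h1 : (fun x => X x * (X x ^ n - X' x ^ n)) =O[𝓝 0] fun x => x ^ (n + 1 + 1) :=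
      (hX.mul ih).congr_right fun x => by ring
    have h2 : (fun x => (X x - X' x) * X' x ^ n) =O[𝓝 0] fun x => x ^ (n + 1 + 1) :=
      (h.mul (hX'.pow n)).congr_right fun x => by ring
    exact (h1.add h2).congr_left fun x => by ring

section LeadingPart

variable {ψ : ℝ × ℝ → ℝ} {G : ℝ → ℝ → ℝ} {M : ℕ} {A B A' B' : ℝ → ℝ}

theorem isBigO_half_sub (hA : ContDiffAt ℝ ∞ A 0) (hB : ContDiffAt ℝ ∞ B 0) (hAB : A 0 = B 0) :
    (fun x => (A x - B x) / 2) =O[𝓝 0] fun x => x :=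
  isBigO_id_of_differentiableAt
    (((hA.sub hB).div_const 2).differentiableAt (by simp)) (by simp [hAB])

theorem contDiffAt_comp_half (hψ : ContDiff ℝ ∞ ψ) (hA : ContDiffAt ℝ ∞ A 0)
    (hB : ContDiffAt ℝ ∞ B 0) :
    ContDiffAt ℝ ∞ (fun x => ψ ((A x - B x) / 2, (A x + B x) / 2)) 0 :=
  hψ.contDiffAt.comp (0 : ℝ) (((hA.sub hB).div_const 2).prodMk ((hA.add hB).div_const 2))

theorem isBigO_pow_of_eq_pow_mul (hψ : ContDiff ℝ ∞ ψ)
    (hG : ∀ x y, G x y = ((x - y) / 2) ^ M * ψ ((x - y) / 2, (x + y) / 2))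
    (hA : ContDiffAt ℝ ∞ A 0) (hB : ContDiffAt ℝ ∞ B 0) (hAB : A 0 = B 0) :
    (fun x => G (A x) (B x)) =O[𝓝 0] fun x => x ^ M := by
  simp only [hG]
  simpa using ((isBigO_half_sub hA hB hAB).pow M).mul
    ((contDiffAt_comp_half hψ hA hB).continuousAt.isBigO_one ℝ)

/-- The leading coefficient depends only on the common value of the arguments and on the
derivative of their difference. -/
theorem isBigO_pow_succ_of_eq_pow_mul (hψ : ContDiff ℝ ∞ ψ)
    (hG : ∀ x y, G x y = ((x - y) / 2) ^ M * ψ ((x - y) / 2, (x + y) / 2))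
    (hA : ContDiffAt ℝ ∞ A 0) (hB : ContDiffAt ℝ ∞ B 0) (hA' : ContDiffAt ℝ ∞ A' 0)
    (hB' : ContDiffAt ℝ ∞ B' 0) (hAB : A 0 = B 0) (hAA' : A 0 = A' 0) (hAB' : A 0 = B' 0)
    {d : ℝ} (hd : HasDerivAt (fun x => A x - B x) d 0)
    (hd' : HasDerivAt (fun x => A' x - B' x) d 0) :
    (fun x => G (A x) (B x) - G (A' x) (B' x)) =O[𝓝 0] fun x => x ^ (M + 1) := by
  have hX := isBigO_half_sub hA hB hAB
  have hX' := isBigO_half_sub hA' hB' (hAA'.symm.trans hAB')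
  have hψ₁ := contDiffAt_comp_half hψ hA hB
  have hψ₂ := contDiffAt_comp_half hψ hA' hB'
  have hsq : (fun x => (A x - B x) / 2 - (A' x - B' x) / 2) =O[𝓝 0] fun x => x ^ 2 := by
    refine isBigO_sq_of_hasDerivAt_zero _
      (((hA.sub hB).div_const 2).sub ((hA'.sub hB').div_const 2)) ?_ ?_
    · simp [hAB, ← hAA', ← hAB']
    · simpa using (hd.div_const 2).fun_sub (hd'.div_const 2)
  have hψd : (fun x => ψ ((A x - B x) / 2, (A x + B x) / 2) -
      ψ ((A' x - B' x) / 2, (A' x + B' x) / 2)) =O[𝓝 0] fun x => x :=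
    isBigO_id_of_differentiableAt ((hψ₁.sub hψ₂).differentiableAt (by simp))
      (by simp [← hAB, ← hAA', ← hAB'])
  have h1 := (hX.pow M).mul hψd
  have h2 := (isBigO_pow_sub_pow hX hX' hsq M).mul (hψ₂.continuousAt.isBigO_one ℝ)
  simp only [mul_one] at h2
  refine ((h1.congr_right fun x => ?_).add h2).congr_left fun x => ?_
  · ring
  · simp only [hG]
    ring

end LeadingPart

section Bulk

variable {D v β r : ℝ} {k : ℕ} {ρ₀ : ℝ → ℝ} {G : ℝ → ℝ → ℝ} {ε δ : ℝ} {m M : ℕ}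
  {ψ : ℝ × ℝ → ℝ}

theorem contDiffAt_Floc_arg (hβ0 : 0 < β) (hβ1 : β < 1) (hρ : ContDiff ℝ ∞ ρ₀) {K : ℕ}
    (j : ℤ) (w : Fin 3) (u : Fin K → Fin 3) :
    ContDiffAt ℝ ∞ (fun x => eta β (v * x / D) w / nu β (v * x / D) w *
      rhoHat β (v * x / D) r x ρ₀ j u) 0 :=
  (contDiffAt_eta_div_nu hβ0 hβ1 v D w).mul (contDiffAt_rhoHat hβ0 hβ1 v D r hρ j u)

theorem contDiffAt_Floc (hβ0 : 0 < β) (hβ1 : β < 1) (hρ : ContDiff ℝ ∞ ρ₀)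
    (hG : ContDiff ℝ ∞ (Function.uncurry G)) {K : ℕ} (j : ℤ) (w u₀ : Fin 3)
    (u : Fin K → Fin 3) :
    ContDiffAt ℝ ∞ (fun x => Floc β (v * x / D) r x ρ₀ G j w u₀ u) 0 :=
  hG.contDiffAt.comp (0 : ℝ) ((contDiffAt_Floc_arg hβ0 hβ1 hρ j w u).prodMk
    (contDiffAt_Floc_arg hβ0 hβ1 hρ (j + 1 - ((u₀ : ℕ) : ℤ)) u₀ u))

theorem contDiffAt_tritSum (hβ0 : 0 < β) (hβ1 : β < 1) (hρ : ContDiff ℝ ∞ ρ₀)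
    (hG : ContDiff ℝ ∞ (Function.uncurry G)) :
    ContDiffAt ℝ ∞ (tritSum D v β r k ρ₀ G ε δ m) 0 := by
  unfold tritSum
  refine ContDiffAt.sum fun w _ => ContDiffAt.sum fun u₀ _ => ContDiffAt.sum fun u' _ => ?_
  have hη := contDiff_eta β v D
  have hν := contDiff_nu β v D
  refine ContDiffAt.mul (ContDiffAt.mul ?_ ?_) ?_
  · exact ((hη w).add (contDiff_const.mul (hν w))).contDiffAt
  · exact ((hν u₀).mul (contDiff_prod fun d _ => hν (u' d))).contDiffAt
  · exact (contDiffAt_Floc hβ0 hβ1 hρ hG _ _ _ _).add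
      (contDiffAt_const.mul (contDiffAt_Floc hβ0 hβ1 hρ hG _ _ _ _))

theorem isBigO_Floc (hβ0 : 0 < β) (hβ1 : β < 1) (hρ : ContDiff ℝ ∞ ρ₀) (hψ : ContDiff ℝ ∞ ψ)
    (hG : ∀ x y, G x y = ((x - y) / 2) ^ M * ψ ((x - y) / 2, (x + y) / 2)) {K : ℕ} (j : ℤ)
    (w u₀ : Fin 3) (u : Fin K → Fin 3) :
    (fun x => Floc β (v * x / D) r x ρ₀ G j w u₀ u) =O[𝓝 0] fun x => x ^ M := by
  refine isBigO_pow_of_eq_pow_mul hψ hG (contDiffAt_Floc_arg hβ0 hβ1 hρ j w u)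
    (contDiffAt_Floc_arg hβ0 hβ1 hρ (j + 1 - ((u₀ : ℕ) : ℤ)) u₀ u) ?_
  simp only [eta_div_nu_zero hβ0 hβ1, rhoHat_zero hβ0 hβ1]

theorem isBigO_Floc_sub (hβ0 : 0 < β) (hβ1 : β < 1) (hρ : ContDiff ℝ ∞ ρ₀)
    (hψ : ContDiff ℝ ∞ ψ)
    (hG : ∀ x y, G x y = ((x - y) / 2) ^ M * ψ ((x - y) / 2, (x + y) / 2)) {K : ℕ} (i j : ℤ)
    (w u₀ : Fin 3) (u : Fin K → Fin 3) :
    (fun x => Floc β (v * x / D) r x ρ₀ G i w u₀ u - Floc β (v * x / D) r x ρ₀ G j w u₀ u)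
      =O[𝓝 0] fun x => x ^ (M + 1) := by
  obtain ⟨c, hc⟩ := exists_hasDerivAt_rhoHat hβ0 hβ1 v D r hρ u
  have ha (w : Fin 3) :=
    ((contDiffAt_eta_div_nu hβ0 hβ1 v D w).differentiableAt (by simp)).hasDerivAt
  have hd (j : ℤ) := ((ha w).fun_mul (hc j)).fun_sub
    ((ha u₀).fun_mul (hc (j + 1 - ((u₀ : ℕ) : ℤ))))
  simp only [eta_div_nu_zero hβ0 hβ1, rhoHat_zero hβ0 hβ1] at hd
  refine isBigO_pow_succ_of_eq_pow_mul hψ hG (contDiffAt_Floc_arg hβ0 hβ1 hρ i w u)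
    (contDiffAt_Floc_arg hβ0 hβ1 hρ (i + 1 - ((u₀ : ℕ) : ℤ)) u₀ u)
    (contDiffAt_Floc_arg hβ0 hβ1 hρ j w u)
    (contDiffAt_Floc_arg hβ0 hβ1 hρ (j + 1 - ((u₀ : ℕ) : ℤ)) u₀ u) ?_ ?_ ?_ (hd i)
    ((hd j).congr_deriv ?_)
  · simp only [eta_div_nu_zero hβ0 hβ1, rhoHat_zero hβ0 hβ1]
  · simp only [eta_div_nu_zero hβ0 hβ1, rhoHat_zero hβ0 hβ1]
  · simp only [eta_div_nu_zero hβ0 hβ1, rhoHat_zero hβ0 hβ1]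
  · push_cast
    ring

theorem isBigO_tritSum (hβ0 : 0 < β) (hβ1 : β < 1) (hρ : ContDiff ℝ ∞ ρ₀)
    (hψ : ContDiff ℝ ∞ ψ)
    (hG : ∀ x y, G x y = ((x - y) / 2) ^ M * ψ ((x - y) / 2, (x + y) / 2)) {a b : ℕ}
    (ha : a = 0 ∨ a = 1 ∧ δ = -1) (hb : b = 0 ∨ b = 1 ∧ ε * (-1) ^ m = -1) :
    tritSum D v β r k ρ₀ G ε δ m =O[𝓝 0] fun x => x ^ (a + (M + b)) := by
  have hη := contDiff_eta β v D
  have hν := contDiff_nu β v D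
  have hweight : ∀ w : Fin 3, (fun x => eta β (v * x / D) w + δ * nu β (v * x / D) w)
      =O[𝓝 0] fun x => x ^ a := by
    intro w
    have hs : ContDiff ℝ ∞ fun x => eta β (v * x / D) w + δ * nu β (v * x / D) w :=
      (hη w).add (contDiff_const.mul (hν w))
    rcases ha with rfl | ⟨rfl, rfl⟩
    · simpa using hs.continuous.continuousAt.isBigO_one ℝ
    · simpa using isBigO_id_of_differentiableAt ((hs.differentiable (by simp)) 0)
        (by simp [eta_zero])
  have hdiff : ∀ (w u₀ : Fin 3) (u' : Fin (k - 1) → Fin 3),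
      (fun x => Floc β (v * x / D) r x ρ₀ G 0 w u₀ u' + ε * (-1 : ℝ) ^ m *
        Floc β (v * x / D) r x ρ₀ G (1 - ((w : ℕ) : ℤ)) w u₀ u') =O[𝓝 0]
        fun x => x ^ (M + b) := by
    intro w u₀ u'
    rcases hb with rfl | ⟨rfl, hb⟩
    · exact (isBigO_Floc hβ0 hβ1 hρ hψ hG _ _ _ _).add
        ((isBigO_Floc hβ0 hβ1 hρ hψ hG _ _ _ _).const_mul_left _)
    · exact (isBigO_Floc_sub hβ0 hβ1 hρ hψ hG 0 (1 - ((w : ℕ) : ℤ)) w u₀ u').congr_left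
        fun x => by rw [hb]; ring
  unfold tritSum
  refine IsBigO.fun_sum fun w _ => IsBigO.fun_sum fun u₀ _ => IsBigO.fun_sum fun u' _ => ?_
  have hmid : (fun x => nu β (v * x / D) u₀ * ∏ d, nu β (v * x / D) (u' d))
      =O[𝓝 0] fun _ => (1 : ℝ) :=
    ((hν u₀).mul (contDiff_prod fun d _ => hν (u' d))).continuous.continuousAt.isBigO_one ℝ
  exact (((hweight w).mul hmid).mul (hdiff w u₀ u')).congr_right fun x => by ring

/-- Orders of vanishing of the sum, rounded up to the next even number. -/
theorem isBigO_tritSum_of_le (hβ0 : 0 < β) (hβ1 : β < 1) (hρ : ContDiff ℝ ∞ ρ₀)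
    (hψ : ContDiff ℝ ∞ ψ) (hGs : ContDiff ℝ ∞ (Function.uncurry G))
    (hG : ∀ x y, G x y = ((x - y) / 2) ^ M * ψ ((x - y) / 2, (x + y) / 2)) {a b e : ℕ}
    (ha : a = 0 ∨ a = 1 ∧ δ = -1) (hb : b = 0 ∨ b = 1 ∧ ε * (-1) ^ m = -1)
    (he : e ≤ a + (M + b) ∨ Odd (a + (M + b)) ∧ e ≤ a + (M + b) + 1) :
    tritSum D v β r k ρ₀ G ε δ m =O[𝓝 0] fun x => x ^ e := by
  have h := isBigO_tritSum (D := D) (v := v) (r := r) (k := k) hβ0 hβ1 hρ hψ hG ha hb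
  rcases he with he | ⟨hodd, he⟩
  · exact h.trans (isBigO_pow_pow_of_le he)
  · exact (isBigO_pow_succ_of_even _ (contDiffAt_tritSum hβ0 hβ1 hρ hGs)
      (tritSum_neg D v β r k ρ₀ G ε δ m) _ hodd h).trans (isBigO_pow_pow_of_le he)

end Bulk


/-- Replacement of f by its leading characteristic part f̂(x,y) = Ĉ((x+y)/2)·((x−y)/2)^m
(content of Lemma 2): with q the LOE exponent of (m,ε,δ), one has
⟨A⟩(Δr) − ⟨Â⟩(Δr) = O(Δr^(q+2)) as Δr → 0⁺, where q+2 = m if m even and ε = δ = 1;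
m+2 if m even otherwise; m+1 if m odd and (ε = −1 or δ = 1); m+3 if m odd otherwise. -/
theorem replacement_by_characteristic_part
    (D v β r : ℝ) (k : ℕ) (ρ₀ : ℝ → ℝ) (f : ℝ → ℝ → ℝ)
    (ε δ : ℝ) (m : ℕ) (Chat : ℝ → ℝ)
    (hD : 0 < D) (hβ0 : 0 < β) (hβ1 : β < 1) (hk : 1 ≤ k)
    (hρ : ContDiff ℝ (⊤ : ℕ∞) ρ₀) (hρpos : ∀ x, 0 < ρ₀ x)
    (hf : ContDiff ℝ (⊤ : ℕ∞) (Function.uncurry f))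
    (hε : ε = 1 ∨ ε = -1) (hδ : δ = 1 ∨ δ = -1)
    (hsym : ∀ x y, f y x = (-1 : ℝ) ^ m * f x y)
    (hlow : ∀ Y : ℝ, ∀ j < m, iteratedDeriv j (fun X => ftilde f X Y) 0 = 0)
    (hchar : ∀ Y : ℝ, iteratedDeriv m (fun X => ftilde f X Y) 0 = (m.factorial : ℝ) * Chat Y)
    (hCbdd : ∃ M : ℝ, ∀ y, |Chat y| ≤ M) (hCne : ∀ y, Chat y ≠ 0)
    :
    ∃ C > 0, ∃ Δ₀ > 0, ∀ Δr : ℝ, 0 < Δr → Δr < Δ₀ →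
      |avgA D v β r k ρ₀ f ε δ m Δr -
          avgA D v β r k ρ₀ (fun x y => Chat ((x + y) / 2) * ((x - y) / 2) ^ m) ε δ m Δr|
        ≤ C * Δr ^ (if Even m then (if ε = 1 ∧ δ = 1 then m else m + 2)
            else (if ε = -1 ∨ δ = 1 then m + 1 else m + 3)) := by
  obtain ⟨hCs, ψ, hψ, hfψ⟩ := exists_contDiff_eq_fst_pow_mul_add
    (fun p : ℝ × ℝ => ftilde f p.1 p.2)
    (hf.comp (by fun_prop : ContDiff ℝ ∞ fun p : ℝ × ℝ => (p.2 + p.1, p.2 - p.1))) m Chat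
    hlow hchar (fun X Y => by simpa [ftilde, ← sub_eq_add_neg] using hsym (Y + X) (Y - X))
  set G : ℝ → ℝ → ℝ := fun x y => f x y - Chat ((x + y) / 2) * ((x - y) / 2) ^ m with hGdef
  have hG : ∀ x y, G x y = ((x - y) / 2) ^ (m + 2) * ψ ((x - y) / 2, (x + y) / 2) := by
    intro x y
    rw [← hfψ]
    simp only [hGdef, ftilde]
    congr 2 <;> ring
  have hGs : ContDiff ℝ ∞ (Function.uncurry G) := by
    refine hf.sub (ContDiff.mul (hCs.comp ?_) ?_) <;> fun_prop
  set e := if Even m then (if ε = 1 ∧ δ = 1 then m else m + 2)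
    else (if ε = -1 ∨ δ = 1 then m + 1 else m + 3) with he
  have hbig : tritSum D v β r k ρ₀ G ε δ m =O[𝓝 0] fun x => x ^ (e + 2) := by
    have key {a b : ℕ} := isBigO_tritSum_of_le (D := D) (v := v) (r := r) (k := k) (ε := ε)
      (δ := δ) (m := m) (a := a) (b := b) (e := e + 2) hβ0 hβ1 hρ hψ hGs hG
    by_cases hm : Even m
    · have hpow : (-1 : ℝ) ^ m = 1 := hm.neg_one_pow
      rcases hε with rfl | rfl <;> rcases hδ with rfl | rfl
      · refine key (a := 0) (b := 0) (by simp) (by simp) (Or.inl ?_)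
        simp [he, hm]
      · refine key (a := 1) (b := 0) (by simp) (by simp) (Or.inr ⟨?_, ?_⟩)
        · grind
        · simp only [he, hm]; norm_num; omega
      · refine key (a := 0) (b := 1) (by simp) (by simp [hpow]) (Or.inr ⟨?_, ?_⟩)
        · grind
        · simp only [he, hm]; norm_num
      · refine key (a := 1) (b := 1) (by simp) (by simp [hpow]) (Or.inl ?_)
        simp only [he, hm]; norm_num; omega
    · have hm' : Odd m := Nat.not_even_iff_odd.1 hm
      have hpow : (-1 : ℝ) ^ m = -1 := hm'.neg_one_pow
      rcases hε with rfl | rfl <;> rcases hδ with rfl | rfl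
      · refine key (a := 0) (b := 0) (by simp) (by simp) (Or.inr ⟨?_, ?_⟩)
        · grind
        · simp only [he, hm]; norm_num
      · refine key (a := 1) (b := 1) (by simp) (by simp [hpow]) (Or.inr ⟨?_, ?_⟩)
        · grind
        · simp only [he, hm]; norm_num; omega
      · refine key (a := 0) (b := 0) (by simp) (by simp) (Or.inr ⟨?_, ?_⟩)
        · grind
        · simp only [he, hm]; norm_num
      · refine key (a := 1) (b := 0) (by simp) (by simp) (Or.inl ?_)
        simp only [he, hm]; norm_num; omega
  obtain ⟨c, hc, hbound⟩ := hbig.exists_pos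
  obtain ⟨d, hd, hball⟩ := Metric.eventually_nhds_iff.1 hbound.bound
  refine ⟨c * (2 * D / β), by positivity, d, hd, fun x hx hxd => ?_⟩
  have hS := hball (y := x) (by simpa [abs_of_pos hx] using hxd)
  rw [Real.norm_eq_abs, Real.norm_eq_abs, abs_of_pos (pow_pos hx _)] at hS
  have heq : avgA D v β r k ρ₀ f ε δ m x -
      avgA D v β r k ρ₀ (fun x y => Chat ((x + y) / 2) * ((x - y) / 2) ^ m) ε δ m x =
      tritSum D v β r k ρ₀ G ε δ m x * (2 * D / (β * x ^ 2)) := by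
    rw [hGdef, ← tritSum_sub]
    change x * tritSum D v β r k ρ₀ f ε δ m x / (β * x ^ 2 / (2 * D) * x) -
      x * tritSum D v β r k ρ₀ (fun x y => Chat ((x + y) / 2) * ((x - y) / 2) ^ m) ε δ m x /
        (β * x ^ 2 / (2 * D) * x) = _
    field_simp
  rw [heq, abs_mul, abs_of_pos (by positivity : 0 < 2 * D / (β * x ^ 2))]
  calc |tritSum D v β r k ρ₀ G ε δ m x| * (2 * D / (β * x ^ 2))
      ≤ c * x ^ (e + 2) * (2 * D / (β * x ^ 2)) := by gcongr
    _ = c * (2 * D / β) * x ^ e := by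
      rw [pow_add]
      field_simp
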